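/- Fix matrices Ψ_0, Ψ_s ∈ ℝ^{n_0 × n_L} (one Ψ_s for each L > s > 0) and row vectors Ψ'_0, Ψ'_t ∈ ℝ^{1 × n_L} (one Ψ'_t for each L > t > 0), and fix real coefficients A_{pq}, B_{pq}, C_{pq} ∈ ℝ for 1 ≤ p ≤ n_L, 1 ≤ q ≤ n_0, coefficients c_s ∈ ℝ for L > s > 0, coefficients D_{t,p} ∈ ℝ for L > t > 0 and 1 ≤ p ≤ n_L, coefficients e_t ∈ ℝ for L > t > 0, coefficients F_p ∈ ℝ for 1 ≤ p ≤ n_L, and φ_1 ∈ ℝ. Define I(U) := Σ_{p,q} A_{pq}·([W]^(L,0)·Ψ_0·[W]^(L,0))_{pq} + Σ_{p,q} B_{pq}·[W]^(L,0)_{pq} + Σ_{L>s>0} c_s · Σ_{p=1}^{n_s} ([W]^(s,0)·Ψ_s·[W]^(L,s))_{pp} + Σ_{p,q} C_{pq}·(b^(L)·Ψ'_0·[W]^(L,0))_{pq} + Σ_{L>t>0} Σ_{p=1}^{n_L} D_{t,p}·([W]^(L,t)·b^(t))_p + Σ_{L>t>0} e_t · Σ_{p=1}^{n_t} (b^(t)·Ψ'_t·[W]^(L,t))_{pp}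 + Σ_{p=1}^{n_L} F_p·b^(L)_p + φ_1. Then I is G-invariant: for every g ∈ G and every weight-space element U, I(gU) = I(U). -/

import Mathlib

open Matrix

noncomputable section

/-- The product `[W]^(s,t) = W^(s) * W^(s-1) * ⋯ * W^(t+1)` of `s - t` weight matrices. -/
def Wprod (n : ℕ → ℕ) (W : ∀ i : ℕ, Matrix (Fin (n i)) (Fin (n (i - 1))) ℝ) :
    (s : ℕ) → (t : ℕ) → Matrix (Fin (n s)) (Fin (n t)) ℝ
  | s, t =>
    if _h : t < s then W s * Wprod n W (s - 1) t
    else Matrix.of fun i j => if (i : ℕ) = (j : ℕ) then (1 : ℝ) else 0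
termination_by s t => s
decreasing_by omega

/-- The group `G`: tuples `g = (g^(L), …, g^(0))` of invertible matrices with
`g^(L) = I`, `g^(0) = I`, and `g^(i)` a product of a positive diagonal matrix and a
permutation matrix for `0 < i < L`. -/
def IsInG (L : ℕ) (n : ℕ → ℕ) (g : ∀ i : ℕ, GL (Fin (n i)) ℝ) : Prop :=
  ((g L : Matrix (Fin (n L)) (Fin (n L)) ℝ) = 1) ∧
  ((g 0 : Matrix (Fin (n 0)) (Fin (n 0)) ℝ) = 1) ∧
  ∀ i : ℕ, 0 < i → i < L →
    ∃ (d : Fin (n i) → ℝ) (π : Equiv.Perm (Fin (n i))),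
      (∀ j, 0 < d j) ∧
      (g i : Matrix (Fin (n i)) (Fin (n i)) ℝ) = Matrix.diagonal d * π.permMatrix ℝ

/-- The action of `g` on the weights: `[gW]^(i) = g^(i) · W^(i) · (g^(i-1))⁻¹`. -/
def actW (n : ℕ → ℕ) (g : ∀ i : ℕ, GL (Fin (n i)) ℝ)
    (W : ∀ i : ℕ, Matrix (Fin (n i)) (Fin (n (i - 1))) ℝ) (i : ℕ) :
    Matrix (Fin (n i)) (Fin (n (i - 1))) ℝ :=
  (g i : Matrix (Fin (n i)) (Fin (n i)) ℝ) * W i *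
    (((g (i - 1))⁻¹ : GL (Fin (n (i - 1))) ℝ) : Matrix (Fin (n (i - 1))) (Fin (n (i - 1))) ℝ)

/-- The action of `g` on the biases: `[gb]^(i) = g^(i) · b^(i)`. -/
def actb (n : ℕ → ℕ) (g : ∀ i : ℕ, GL (Fin (n i)) ℝ)
    (b : ∀ i : ℕ, Matrix (Fin (n i)) (Fin 1) ℝ) (i : ℕ) : Matrix (Fin (n i)) (Fin 1) ℝ :=
  (g i : Matrix (Fin (n i)) (Fin (n i)) ℝ) * b i

/-- The invariant polynomial functional `I(U)` built from the stable polynomial terms. -/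
def Ired (L : ℕ) (n : ℕ → ℕ)
    (Ψ0 : Matrix (Fin (n 0)) (Fin (n L)) ℝ)
    (Ψs : ∀ _s : ℕ, Matrix (Fin (n 0)) (Fin (n L)) ℝ)
    (Ψ'0 : Matrix (Fin 1) (Fin (n L)) ℝ)
    (Ψ't : ∀ _t : ℕ, Matrix (Fin 1) (Fin (n L)) ℝ)
    (A B C : Fin (n L) → Fin (n 0) → ℝ)
    (c : ℕ → ℝ) (D : ∀ _t : ℕ, Fin (n L) → ℝ) (e : ℕ → ℝ)
    (F : Fin (n L) → ℝ) (φ1 : ℝ)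
    (W : ∀ i : ℕ, Matrix (Fin (n i)) (Fin (n (i - 1))) ℝ)
    (b : ∀ i : ℕ, Matrix (Fin (n i)) (Fin 1) ℝ) : ℝ :=
  (∑ p, ∑ q, A p q * (Wprod n W L 0 * Ψ0 * Wprod n W L 0) p q)
  + (∑ p, ∑ q, B p q * (Wprod n W L 0) p q)
  + (∑ s ∈ Finset.Ioo 0 L, c s * ∑ p, (Wprod n W s 0 * Ψs s * Wprod n W L s) p p)
  + (∑ p, ∑ q, C p q * (b L * Ψ'0 * Wprod n W L 0) p q)
  + (∑ t ∈ Finset.Ioo 0 L, ∑ p, D t p * (Wprod n W L t * b t) p 0)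
  + (∑ t ∈ Finset.Ioo 0 L, e t * ∑ p, (b t * Ψ't t * Wprod n W L t) p p)
  + (∑ p, F p * b L p 0) + φ1

theorem Wprod_self (n : ℕ → ℕ) (W : ∀ i : ℕ, Matrix (Fin (n i)) (Fin (n (i - 1))) ℝ) (t : ℕ) :
    Wprod n W t t = 1 := by
  rw [Wprod, dif_neg (lt_irrefl t)]
  ext i j
  simp [Matrix.one_apply, Fin.ext_iff]

theorem Wprod_of_lt (n : ℕ → ℕ) (W : ∀ i : ℕ, Matrix (Fin (n i)) (Fin (n (i - 1))) ℝ)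
    {s t : ℕ} (h : t < s) : Wprod n W s t = W s * Wprod n W (s - 1) t := by
  rw [Wprod, dif_pos h]

theorem Wprod_actW (n : ℕ → ℕ) (g : ∀ i : ℕ, GL (Fin (n i)) ℝ)
    (W : ∀ i : ℕ, Matrix (Fin (n i)) (Fin (n (i - 1))) ℝ) {s t : ℕ} (h : t ≤ s) :
    Wprod n (actW n g W) s t = (g s).val * Wprod n W s t * ((g t)⁻¹).val := by
  induction s, h using Nat.le_induction with
  | base => rw [Wprod_self, Wprod_self, Matrix.mul_one, Units.mul_inv]
  | succ s h ih =>
    rw [Wprod_of_lt n _ (Nat.lt_succ_of_le h), Wprod_of_lt n W (Nat.lt_succ_of_le h)]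
    replace ih : Wprod n (actW n g W) (s + 1 - 1) t =
      (g (s + 1 - 1)).val * Wprod n W (s + 1 - 1) t * ((g t)⁻¹).val := ih
    rw [ih, actW]
    simp only [Matrix.mul_assoc]
    rw [← Matrix.mul_assoc ((g (s + 1 - 1))⁻¹).val, Units.inv_mul, Matrix.one_mul]

/-- The diagonal sum of a matrix is invariant under conjugation by an invertible matrix. -/
theorem sum_diag_conj {m : ℕ} (u : GL (Fin m) ℝ) (M : Matrix (Fin m) (Fin m) ℝ) :
    ∑ p, (u.val * M * (u⁻¹).val) p p = ∑ p, M p p :=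
  Matrix.trace_units_conj u M

/-- the functional `I` is `G`-invariant: `I(gU) = I(U)` for every `g ∈ G`
and every weight-space element `U`. -/
theorem Ired_G_invariant (L : ℕ) (hL : 1 ≤ L) (n : ℕ → ℕ) (hn : ∀ i, 1 ≤ n i)
    (Ψ0 : Matrix (Fin (n 0)) (Fin (n L)) ℝ)
    (Ψs : ∀ _s : ℕ, Matrix (Fin (n 0)) (Fin (n L)) ℝ)
    (Ψ'0 : Matrix (Fin 1) (Fin (n L)) ℝ)
    (Ψ't : ∀ _t : ℕ, Matrix (Fin 1) (Fin (n L)) ℝ)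
    (A B C : Fin (n L) → Fin (n 0) → ℝ)
    (c : ℕ → ℝ) (D : ∀ _t : ℕ, Fin (n L) → ℝ) (e : ℕ → ℝ)
    (F : Fin (n L) → ℝ) (φ1 : ℝ)
    (g : ∀ i : ℕ, GL (Fin (n i)) ℝ) (hg : IsInG L n g)
    (W : ∀ i : ℕ, Matrix (Fin (n i)) (Fin (n (i - 1))) ℝ)
    (b : ∀ i : ℕ, Matrix (Fin (n i)) (Fin 1) ℝ) :
    Ired L n Ψ0 Ψs Ψ'0 Ψ't A B C c D e F φ1 (actW n g W) (actb n g b)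
      = Ired L n Ψ0 Ψs Ψ'0 Ψ't A B C c D e F φ1 W b := by
  obtain ⟨hgL, hg0, -⟩ := hg
  replace hgL : g L = 1 := Units.ext hgL
  replace hg0 : g 0 = 1 := Units.ext hg0
  have hW0 : Wprod n (actW n g W) L 0 = Wprod n W L 0 := by
    simp [Wprod_actW n g W (Nat.zero_le L), hgL, hg0]
  have hbL : actb n g b L = b L := by simp [actb, hgL]
  have hWs0 (s : ℕ) : Wprod n (actW n g W) s 0 = (g s).val * Wprod n W s 0 := by
    simp [Wprod_actW n g W (Nat.zero_le s), hg0]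
  have hWLs {s : ℕ} (hs : s ∈ Finset.Ioo 0 L) :
      Wprod n (actW n g W) L s = Wprod n W L s * ((g s)⁻¹).val := by
    simp [Wprod_actW n g W (Finset.mem_Ioo.mp hs).2.le, hgL]
  unfold Ired
  rw [hW0, hbL]
  congr 3
  · congr 1
    · congr 2
      refine Finset.sum_congr rfl fun s hs => ?_
      rw [hWs0, hWLs hs, ← sum_diag_conj (g s) (Wprod n W s 0 * Ψs s * Wprod n W L s)]
      simp only [Matrix.mul_assoc]
    · refine Finset.sum_congr rfl fun t ht => ?_
      rw [hWLs ht, actb, Matrix.mul_assoc, ← Matrix.mul_assoc ((g t)⁻¹).val, Units.inv_mul,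
        Matrix.one_mul]
  · refine Finset.sum_congr rfl fun t ht => ?_
    rw [hWLs ht, actb, ← sum_diag_conj (g t) (b t * Ψ't t * Wprod n W L t)]
    simp only [Matrix.mul_assoc]
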